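/- For every integer n ≥ 2 one has the polynomial identity ρ(x) S_{n−1}(x) = C_{2,n}(x) P_n(x) + D_{2,n}(x) P_{n−1}(x), where C_{2,n} and D_{2,n} are polynomials of degree at most d−1 and d, respectively. -/

import Mathlib

open Polynomial MeasureTheory Finset

noncomputable section

/-- The `k`-th derivative of a real polynomial. -/
def iterDeriv (k : ℕ) (f : Polynomial ℝ) : Polynomial ℝ := Polynomial.derivative^[k] f

/-- The Jacobi measure `dμ^{α,β}(x) = (1-x)^α (1+x)^β dx` on `[-1,1]`. -/
def jacobiMeasure (α β : ℝ) : Measure ℝ :=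
  (volume.restrict (Set.Icc (-1 : ℝ) 1)).withDensity
    fun x => ENNReal.ofReal ((1 - x) ^ α * (1 + x) ^ β)

/-- The Jacobi–Sobolev inner product
`⟨f,g⟩_S = ∫ f g dμ^{α,β} + ∑_{j=1}^N ∑_{k=0}^{d_j} λ_{j,k} f^{(k)}(c_j) g^{(k)}(c_j)`. -/
def sobolevIP (α β : ℝ) {N : ℕ} (c : Fin N → ℝ) (dd : Fin N → ℕ)
    (lam : Fin N → ℕ → ℝ) (f g : Polynomial ℝ) : ℝ :=
  (∫ x, f.eval x * g.eval x ∂(jacobiMeasure α β)) +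
    ∑ j : Fin N, ∑ k ∈ Finset.range (dd j + 1),
      lam j k * (iterDeriv k f).eval (c j) * (iterDeriv k g).eval (c j)

/-- The degree-`k` Taylor polynomial of `f` centred at `c`:
`Q_k(x,c;f) = ∑_{ν=0}^k f^{(ν)}(c)(x-c)^ν/ν!` (as a polynomial in `x`). -/
def taylorPoly (k : ℕ) (c : ℝ) (f : Polynomial ℝ) : Polynomial ℝ :=
  ∑ ν ∈ Finset.range (k + 1),
    Polynomial.C ((iterDeriv ν f).eval c / Nat.factorial ν) * (X - Polynomial.C c) ^ ν

/-- `ρ(x) = ∏_{j=1}^N (x-c_j)^{d_j+1}`. -/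
def rhoPoly {N : ℕ} (c : Fin N → ℝ) (dd : Fin N → ℕ) : Polynomial ℝ :=
  ∏ j : Fin N, (X - Polynomial.C (c j)) ^ (dd j + 1)

/-- `ρ_{j,k}(x) = ρ(x)/(x-c_j)^{k+1} = (x-c_j)^{d_j-k} ∏_{i≠j} (x-c_i)^{d_i+1}`. -/
def rhoJK {N : ℕ} (c : Fin N → ℝ) (dd : Fin N → ℕ) (j : Fin N) (k : ℕ) : Polynomial ℝ :=
  (X - Polynomial.C (c j)) ^ (dd j - k) *
    ∏ i ∈ Finset.univ.erase j, (X - Polynomial.C (c i)) ^ (dd i + 1)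

/-- `â_n(x) = -n((2n+α+β)x+β-α)/(2n+α+β)`. -/
def ahat (α β : ℝ) (n : ℕ) : Polynomial ℝ :=
  Polynomial.C (-(n : ℝ) / (2 * (n : ℝ) + α + β)) *
    (Polynomial.C (2 * (n : ℝ) + α + β) * X + Polynomial.C (β - α))

/-- `b̂_n = 4n(n+α)(n+β)(n+α+β)/((2n+α+β)²(2n+α+β-1))`. -/
def bhat (α β : ℝ) (n : ℕ) : ℝ :=
  4 * (n : ℝ) * ((n : ℝ) + α) * ((n : ℝ) + β) * ((n : ℝ) + α + β) /
    ((2 * (n : ℝ) + α + β) ^ 2 * (2 * (n : ℝ) + α + β - 1))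

/-- `ĉ_n(x) = (n+α+β)((2n+α+β)x+α-β)/(2n+α+β)`. -/
def chat (α β : ℝ) (n : ℕ) : Polynomial ℝ :=
  Polynomial.C (((n : ℝ) + α + β) / (2 * (n : ℝ) + α + β)) *
    (Polynomial.C (2 * (n : ℝ) + α + β) * X + Polynomial.C (α - β))

/-- `d̂_n = -(2n+α+β-1)`. -/
def dhat (α β : ℝ) (n : ℕ) : ℝ := -(2 * (n : ℝ) + α + β - 1)

/-- `γ_{1,n} = (β²-α²)/((2n+α+β)(2n+α+β+2))`. -/
def gamma1 (α β : ℝ) (n : ℕ) : ℝ :=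
  (β ^ 2 - α ^ 2) / ((2 * (n : ℝ) + α + β) * (2 * (n : ℝ) + α + β + 2))

/-- `γ_{2,n} = 4n(n+α)(n+β)(n+α+β)/((2n+α+β)²((2n+α+β)²-1))`. -/
def gamma2 (α β : ℝ) (n : ℕ) : ℝ :=
  4 * (n : ℝ) * ((n : ℝ) + α) * ((n : ℝ) + β) * ((n : ℝ) + α + β) /
    ((2 * (n : ℝ) + α + β) ^ 2 * ((2 * (n : ℝ) + α + β) ^ 2 - 1))

lemma isFiniteMeasure_jacobiMeasure {α β : ℝ} (hα : -1 < α) (hβ : -1 < β) :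
    IsFiniteMeasure (jacobiMeasure α β) := by
  have h1 : IntervalIntegrable (fun x : ℝ => (1 - x) ^ α * (1 + x) ^ β) volume 0 1 := by
    have h := (intervalIntegral.intervalIntegrable_rpow' (a := 1) (b := 0) hα).comp_sub_left 1
    simp only [sub_self, sub_zero] at h
    refine h.mul_continuousOn ?_
    rw [Set.uIcc_of_le zero_le_one]
    exact ContinuousOn.rpow_const (by fun_prop) fun x hx => Or.inl (by linarith [hx.1])
  have h2 : IntervalIntegrable (fun x : ℝ => (1 - x) ^ α * (1 + x) ^ β) volume (-1) 0 := by
    have h := (intervalIntegral.intervalIntegrable_rpow' (a := 0) (b := 1) hβ).comp_add_left 1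
    simp only [zero_sub, sub_self] at h
    refine h.continuousOn_mul ?_
    rw [Set.uIcc_of_le (by norm_num)]
    exact ContinuousOn.rpow_const (by fun_prop) fun x hx => Or.inl (by linarith [hx.2])
  have h3 := (intervalIntegrable_iff_integrableOn_Icc_of_le (by norm_num)).1 (h2.trans h1)
  exact isFiniteMeasure_withDensity_ofReal h3.2

lemma ae_jacobiMeasure_mem_Icc (α β : ℝ) :
    ∀ᵐ x ∂(jacobiMeasure α β), x ∈ Set.Icc (-1 : ℝ) 1 :=
  (withDensity_absolutelyContinuous _ _).ae_le (ae_restrict_mem measurableSet_Icc)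

lemma integrable_eval_jacobiMeasure {α β : ℝ} (hα : -1 < α) (hβ : -1 < β) (p : ℝ[X]) :
    Integrable (fun x => p.eval x) (jacobiMeasure α β) := by
  have := isFiniteMeasure_jacobiMeasure hα hβ
  obtain ⟨M, hM⟩ := (isCompact_Icc (a := (-1 : ℝ)) (b := 1)).exists_bound_of_continuousOn
    p.continuous.continuousOn
  exact Integrable.of_bound p.continuous.aestronglyMeasurable M
    ((ae_jacobiMeasure_mem_Icc α β).mono hM)

lemma integral_sq_jacobiMeasure_pos {α β : ℝ} (hα : -1 < α) (hβ : -1 < β) {p : ℝ[X]}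
    (hp : p ≠ 0) : 0 < ∫ x, (p.eval x) ^ 2 ∂(jacobiMeasure α β) := by
  have hint : Integrable (fun x => (p.eval x) ^ 2) (jacobiMeasure α β) := by
    refine (integrable_eval_jacobiMeasure hα hβ (p * p)).congr (ae_of_all _ fun x => ?_)
    simp only [eval_mul, sq]
  refine lt_of_le_of_ne (integral_nonneg fun x => sq_nonneg _) fun h0 => ?_
  have hz := (integral_eq_zero_iff_of_nonneg (fun x => sq_nonneg (p.eval x)) hint).1 h0.symm
  have hmeas : Measurable fun x : ℝ => ENNReal.ofReal ((1 - x) ^ α * (1 + x) ^ β) := by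
    fun_prop
  have hz' := (ae_withDensity_iff hmeas).1 hz
  rw [ae_restrict_iff' measurableSet_Icc] at hz'
  have hroots : ∀ᵐ x : ℝ, x ∉ p.roots.toFinset :=
    (Finset.finite_toSet _).measure_zero volume |> measure_eq_zero_iff_ae_notMem.1
  have hsub : ∀ᵐ x : ℝ, x ∉ Set.Ioo (-1 : ℝ) 1 := by
    filter_upwards [hz', hroots] with x hx hr hxI
    refine hr ?_
    have hw : 0 < (1 - x) ^ α * (1 + x) ^ β :=
      mul_pos (Real.rpow_pos_of_pos (by linarith [hxI.2]) _)
        (Real.rpow_pos_of_pos (by linarith [hxI.1]) _)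
    have := hx (Set.Ioo_subset_Icc_self hxI) (by simpa using hw)
    simpa [hp] using this
  have := measure_eq_zero_iff_ae_notMem.2 hsub
  rw [Real.volume_Ioo] at this
  norm_num at this

/-- Integration of polynomials against the Jacobi measure, as a linear functional. -/
def jacobiFunctional {α β : ℝ} (hα : -1 < α) (hβ : -1 < β) : ℝ[X] →ₗ[ℝ] ℝ where
  toFun p := ∫ x, p.eval x ∂(jacobiMeasure α β)
  map_add' p q := by
    simp only [eval_add]
    exact integral_add (integrable_eval_jacobiMeasure hα hβ p)
      (integrable_eval_jacobiMeasure hα hβ q)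
  map_smul' a p := by
    simp only [eval_smul, smul_eq_mul, RingHom.id_apply]
    exact integral_const_mul _ _

lemma iterDeriv_add (k : ℕ) (f g : ℝ[X]) :
    iterDeriv k (f + g) = iterDeriv k f + iterDeriv k g :=
  iterate_map_add derivative k f g

lemma iterDeriv_smul (k : ℕ) (a : ℝ) (f : ℝ[X]) :
    iterDeriv k (a • f) = a • iterDeriv k f :=
  iterate_derivative_smul a f k

lemma eval_iterDeriv_div_factorial (k : ℕ) (c : ℝ) (f : ℝ[X]) :
    (iterDeriv k f).eval c / Nat.factorial k = (taylor c f).coeff k := by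
  have h := congrFun (factorial_smul_hasseDeriv (R := ℝ) k) f
  have h' : iterDeriv k f = (k.factorial : ℝ) • hasseDeriv k f := by
    rw [iterDeriv, ← h]
    simp [Nat.cast_smul_eq_nsmul]
  have : (k.factorial : ℝ) ≠ 0 := by positivity
  rw [taylor_coeff, h', eval_smul, smul_eq_mul]
  field_simp

lemma taylorPoly_eq_sum_coeff (k : ℕ) (c : ℝ) (f : ℝ[X]) :
    taylorPoly k c f =
      ∑ ν ∈ Finset.range (k + 1), Polynomial.C ((taylor c f).coeff ν) * (X - Polynomial.C c) ^ ν := by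
  simp only [taylorPoly, eval_iterDeriv_div_factorial]

lemma taylorPoly_sub (k : ℕ) (c : ℝ) (f g : ℝ[X]) :
    taylorPoly k c (f - g) = taylorPoly k c f - taylorPoly k c g := by
  simp only [taylorPoly_eq_sum_coeff, map_sub, coeff_sub, sub_mul, Finset.sum_sub_distrib]

lemma taylorPoly_C_mul (k : ℕ) (c a : ℝ) (f : ℝ[X]) :
    taylorPoly k c (Polynomial.C a * f) = Polynomial.C a * taylorPoly k c f := by
  simp only [taylorPoly_eq_sum_coeff, taylor_mul, taylor_C, coeff_C_mul, map_mul, mul_assoc,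
    Finset.mul_sum]

lemma taylorPoly_X_mul (k : ℕ) (c : ℝ) (f : ℝ[X]) :
    taylorPoly k c (X * f) = X * taylorPoly k c f -
      Polynomial.C ((iterDeriv k f).eval c / Nat.factorial k) * (X - Polynomial.C c) ^ (k + 1) := by
  rw [eval_iterDeriv_div_factorial]
  simp only [taylorPoly_eq_sum_coeff]
  induction k with
  | zero => simp [taylor_mul, add_mul]; ring
  | succ k ih =>
    rw [Finset.sum_range_succ, ih, Finset.sum_range_succ _ (k + 1)]
    simp only [taylor_mul, taylor_X, add_mul, coeff_add, coeff_X_mul, coeff_C_mul, map_add, map_mul]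
    ring

lemma natDegree_taylorPoly_le (k : ℕ) (c : ℝ) (f : ℝ[X]) : (taylorPoly k c f).natDegree ≤ k := by
  refine natDegree_sum_le_of_forall_le _ _ fun ν hν => ?_
  refine (natDegree_C_mul_le _ _).trans ?_
  rw [natDegree_pow, natDegree_X_sub_C, mul_one]
  exact Nat.lt_succ_iff.1 (Finset.mem_range.1 hν)

section Rho

variable {N : ℕ} (c : Fin N → ℝ) (dd : Fin N → ℕ)

lemma pow_mul_rhoJK {j : Fin N} {k : ℕ} (hk : k ≤ dd j) :
    (X - Polynomial.C (c j)) ^ (k + 1) * rhoJK c dd j k = rhoPoly c dd := by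
  rw [rhoJK, rhoPoly, ← mul_assoc, ← pow_add, ← Finset.mul_prod_erase _ _ (Finset.mem_univ j)]
  congr 2
  omega

lemma natDegree_rhoPoly : (rhoPoly c dd).natDegree = ∑ j, (dd j + 1) := by
  rw [rhoPoly, natDegree_prod_of_monic _ _ fun j _ => (monic_X_sub_C _).pow _]
  simp

lemma natDegree_rhoJK {j : Fin N} {k : ℕ} (hk : k ≤ dd j) :
    k + 1 + (rhoJK c dd j k).natDegree = ∑ j, (dd j + 1) := by
  have hm : (rhoJK c dd j k).Monic :=
    ((monic_X_sub_C _).pow _).mul (monic_prod_of_monic _ _ fun i _ => (monic_X_sub_C _).pow _)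
  rw [← natDegree_rhoPoly c dd, ← pow_mul_rhoJK c dd hk,
    ((monic_X_sub_C _).pow _).natDegree_mul hm]
  simp

lemma natDegree_sum_taylorPoly_mul_rhoJK_le (a : Fin N → ℕ → ℝ) (f : ℝ[X]) :
    (∑ j : Fin N, ∑ k ∈ Finset.range (dd j + 1),
      Polynomial.C (a j k) * (taylorPoly k (c j) f * rhoJK c dd j k)).natDegree ≤
      ∑ j, (dd j + 1) - 1 := by
  refine natDegree_sum_le_of_forall_le _ _ fun j _ => natDegree_sum_le_of_forall_le _ _ fun k hk => ?_
  have hk' := Nat.lt_succ_iff.1 (Finset.mem_range.1 hk)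
  have h1 := natDegree_rhoJK c dd hk'
  have h2 := natDegree_taylorPoly_le k (c j) f
  have h3 := natDegree_mul_le (p := taylorPoly k (c j) f) (q := rhoJK c dd j k)
  have h4 := natDegree_C_mul_le (a j k) (taylorPoly k (c j) f * rhoJK c dd j k)
  omega

end Rho

section Orthogonal

variable {L : ℝ[X] →ₗ[ℝ] ℝ} {P : ℕ → ℝ[X]} {h : ℕ → ℝ}

lemma exists_eq_sum_smul_of_natDegree_eq (hPm : ∀ m, (P m).Monic) (hPd : ∀ m, (P m).natDegree = m)
    (m : ℕ) (q : ℝ[X]) (hq : q.degree < m) :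
    ∃ a : ℕ → ℝ, q = ∑ i ∈ Finset.range m, a i • P i := by
  induction m generalizing q with
  | zero => exact ⟨0, by simpa using hq⟩
  | succ m ih =>
    have hdeg : (P m).degree = m := by rw [degree_eq_natDegree (hPm m).ne_zero, hPd]
    obtain ⟨a, ha⟩ := ih (q - q.coeff m • P m) <| by
      rw [degree_lt_iff_coeff_zero] at hq ⊢
      intro i hi
      rcases hi.eq_or_lt with rfl | hi
      · have := hPm m
        rw [Monic, leadingCoeff, hPd] at this
        simp [this]
      · rw [coeff_sub, coeff_smul, hq i hi,
          coeff_eq_zero_of_natDegree_lt (p := P m) ((hPd m).trans_lt hi)]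
        simp
    refine ⟨Function.update a m (q.coeff m), ?_⟩
    rw [Finset.sum_range_succ, Function.update_self,
      Finset.sum_congr rfl fun i hi => by
        rw [Function.update_of_ne (Finset.mem_range.1 hi).ne], ← ha]
    ring

lemma eq_sum_orthogonal (hPm : ∀ m, (P m).Monic) (hPd : ∀ m, (P m).natDegree = m)
    (hPo : ∀ m l, m ≠ l → L (P m * P l) = 0) (hh : ∀ m, L (P m * P m) = h m) (h0 : ∀ m, h m ≠ 0)
    (m : ℕ) (q : ℝ[X]) (hq : q.degree < m) :
    q = ∑ i ∈ Finset.range m, (L (P i * q) / h i) • P i := by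
  obtain ⟨a, ha⟩ := exists_eq_sum_smul_of_natDegree_eq hPm hPd m q hq
  conv_lhs => rw [ha]
  refine Finset.sum_congr rfl fun i hi => ?_
  congr 1
  rw [ha, Finset.mul_sum, map_sum, Finset.sum_eq_single_of_mem i hi fun l _ hl => by
    rw [mul_smul_comm, map_smul, hPo i l hl.symm, smul_zero],
    mul_smul_comm, map_smul, hh, smul_eq_mul, mul_div_cancel_right₀ _ (h0 i)]

lemma apply_mul_eq_zero_of_degree_lt (hPm : ∀ m, (P m).Monic) (hPd : ∀ m, (P m).natDegree = m)
    (hPo : ∀ m l, m ≠ l → L (P m * P l) = 0) (m : ℕ) (q : ℝ[X]) (hq : q.degree < m) :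
    L (P m * q) = 0 := by
  obtain ⟨a, ha⟩ := exists_eq_sum_smul_of_natDegree_eq hPm hPd m q hq
  rw [ha, Finset.mul_sum, map_sum]
  refine Finset.sum_eq_zero fun i hi => ?_
  rw [mul_smul_comm, map_smul, hPo m i (Finset.mem_range.1 hi).ne', smul_zero]

/-- In a three-term recurrence, the last coefficient is the ratio of consecutive square norms. -/
lemma norm_sq_eq_mul_of_recurrence (hPm : ∀ m, (P m).Monic) (hPd : ∀ m, (P m).natDegree = m)
    (hPo : ∀ m l, m ≠ l → L (P m * P l) = 0) (hh : ∀ m, L (P m * P m) = h m)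
    {g1 g2 : ℝ} {m : ℕ} (hrec : X * P (m + 1) =
      P (m + 2) + Polynomial.C g1 * P (m + 1) + Polynomial.C g2 * P m) :
    h (m + 1) = g2 * h m := by
  have hdeg : (X * P m - P (m + 1)).degree < ((m + 1 : ℕ) : WithBot ℕ) := by
    have hX : (X * P m).degree = ((m + 1 : ℕ) : WithBot ℕ) := by
      rw [degree_eq_natDegree (monic_X.mul (hPm m)).ne_zero, monic_X.natDegree_mul (hPm m), hPd,
        natDegree_X, add_comm]
    rw [← hX]
    refine degree_sub_lt_left ?_ (monic_X.mul (hPm m)).ne_zero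
      ((monic_X.mul (hPm m)).leadingCoeff.trans (hPm _).leadingCoeff.symm)
    rw [hX, degree_eq_natDegree (hPm _).ne_zero, hPd]
  have h1 := apply_mul_eq_zero_of_degree_lt hPm hPd hPo (m + 1) _ hdeg
  have h2 : P (m + 1) * (X * P m - P (m + 1)) = P (m + 2) * P m + g1 • (P (m + 1) * P m)
      + g2 • (P m * P m) - P (m + 1) * P (m + 1) := by
    simp only [smul_eq_C_mul]
    linear_combination P m * hrec
  rw [h2, map_sub, map_add, map_add, map_smul, map_smul, hPo _ _ (by omega), hPo _ _ (by omega),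
    hh, hh] at h1
  simp only [smul_eq_mul] at h1
  linarith

/-- The differentiated Christoffel–Darboux formula. -/
lemma christoffel_darboux_taylor (hPm : ∀ m, (P m).Monic) (hPd : ∀ m, (P m).natDegree = m)
    (h0 : ∀ m, h m ≠ 0) (g1 g2 : ℕ → ℝ)
    (hrec : ∀ m, X * P (m + 1) =
      P (m + 2) + Polynomial.C (g1 m) * P (m + 1) + Polynomial.C (g2 m) * P m)
    (hg : ∀ m, h (m + 1) = g2 m * h m) (c : ℝ) (k m : ℕ) :
    (X - Polynomial.C c) ^ (k + 1) *
        ∑ i ∈ Finset.range (m + 1), Polynomial.C ((iterDeriv k (P i)).eval c / h i) * P i =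
      Polynomial.C (Nat.factorial k / h m) *
        (taylorPoly k c (P m) * P (m + 1) - taylorPoly k c (P (m + 1)) * P m) := by
  have hk : (Nat.factorial k : ℝ) ≠ 0 := by positivity
  have hCk : ∀ m (a : ℝ), Polynomial.C (a / h m) =
      Polynomial.C (Nat.factorial k / h m) * Polynomial.C (a / Nat.factorial k) := by
    intro m a
    rw [← Polynomial.C_mul]
    congr 1
    have := h0 m
    field_simp
  induction m with
  | zero =>
    have hP0 : P 0 = 1 := (hPm 0).natDegree_eq_zero.1 (hPd 0)
    have hP1 : P 1 = X * P 0 - Polynomial.C (-(P 1).coeff 0) * P 0 := by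
      conv_lhs => rw [(hPm 1).eq_X_add_C (hPd 1)]
      simp [hP0]
    have ht := congrArg (taylorPoly k c) hP1
    rw [taylorPoly_sub, taylorPoly_C_mul, taylorPoly_X_mul] at ht
    rw [Finset.sum_range_one, zero_add, hCk]
    linear_combination (-Polynomial.C (k.factorial / h 0) * taylorPoly k c (P 0)) * hP1 +
      Polynomial.C (k.factorial / h 0) * P 0 * ht
  | succ m ih =>
    have hP : P (m + 2) = X * P (m + 1) - Polynomial.C (g1 m) * P (m + 1)
        - Polynomial.C (g2 m) * P m := by linear_combination -hrec m
    have ht := congrArg (taylorPoly k c) hP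
    rw [taylorPoly_sub, taylorPoly_sub, taylorPoly_C_mul, taylorPoly_C_mul, taylorPoly_X_mul] at ht
    have hC : Polynomial.C (k.factorial / h m) =
        Polynomial.C (k.factorial / h (m + 1)) * Polynomial.C (g2 m) := by
      rw [← Polynomial.C_mul]
      congr 1
      have h1 := h0 m
      have h2 := h0 (m + 1)
      field_simp
      rw [hg m, mul_comm]
    rw [Finset.sum_range_succ, mul_add, ih, ht, hP, hC, hCk (m + 1) (eval c _)]
    ring

end Orthogonal

section Sobolev

variable {α β : ℝ} {N : ℕ} (c : Fin N → ℝ) (dd : Fin N → ℕ) (lam : Fin N → ℕ → ℝ)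

/-- The Jacobi–Sobolev pairing with a fixed polynomial, as a linear functional. -/
def sobolevFunctional (hα : -1 < α) (hβ : -1 < β) (g : ℝ[X]) : ℝ[X] →ₗ[ℝ] ℝ where
  toFun f := sobolevIP α β c dd lam f g
  map_add' p q := by
    have h1 : ∫ x, (p + q).eval x * g.eval x ∂(jacobiMeasure α β) =
        (∫ x, p.eval x * g.eval x ∂(jacobiMeasure α β)) +
          ∫ x, q.eval x * g.eval x ∂(jacobiMeasure α β) := by
      simpa only [jacobiFunctional, LinearMap.coe_mk, AddHom.coe_mk, ← add_mul, eval_mul] using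
        (jacobiFunctional hα hβ).map_add (p * g) (q * g)
    rw [sobolevIP, h1]
    simp only [sobolevIP, iterDeriv_add, eval_add, mul_add, add_mul, Finset.sum_add_distrib]
    ring
  map_smul' a p := by
    have h1 : ∫ x, (a • p).eval x * g.eval x ∂(jacobiMeasure α β) =
        a * ∫ x, p.eval x * g.eval x ∂(jacobiMeasure α β) := by
      simpa only [jacobiFunctional, LinearMap.coe_mk, AddHom.coe_mk, ← smul_mul_assoc, eval_mul,
        smul_eq_mul] using (jacobiFunctional hα hβ).map_smul a (p * g)
    rw [sobolevIP, h1]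
    simp only [sobolevIP, iterDeriv_smul, eval_smul, smul_eq_mul, RingHom.id_apply, mul_add,
      Finset.mul_sum]
    congr 1
    exact Finset.sum_congr rfl fun j _ => Finset.sum_congr rfl fun k _ => by ring

lemma sobolevIP_eq_zero_of_degree_lt (hα : -1 < α) (hβ : -1 < β) {m : ℕ} {g : ℝ[X]}
    (hg : ∀ l < m, sobolevIP α β c dd lam (X ^ l) g = 0) {q : ℝ[X]} (hq : q.degree < m) :
    sobolevIP α β c dd lam q g = 0 := by
  have hX : ∀ i, (X ^ i : ℝ[X]).natDegree = i := fun i => natDegree_X_pow i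
  obtain ⟨a, ha⟩ := exists_eq_sum_smul_of_natDegree_eq (fun i => monic_X_pow i) hX m q hq
  change sobolevFunctional c dd lam hα hβ g q = 0
  rw [ha, map_sum]
  refine Finset.sum_eq_zero fun i hi => ?_
  rw [map_smul, show sobolevFunctional c dd lam hα hβ g (X ^ i) = 0 from
    hg i (Finset.mem_range.1 hi), smul_zero]

end Sobolev

/-- The connection formula `ρ Sₘ = A Pₘ + B Pₘ₋₁`, stated with `m + 1` in place of `m`. -/
lemma rhoPoly_mul_eq {α β : ℝ} (hα : -1 < α) (hβ : -1 < β)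
    {N : ℕ} (c : Fin N → ℝ) (dd : Fin N → ℕ) (lam : Fin N → ℕ → ℝ)
    {P : ℕ → ℝ[X]} (hPm : ∀ m, (P m).Monic) (hPd : ∀ m, (P m).natDegree = m)
    {h : ℕ → ℝ} (h0 : ∀ m, h m ≠ 0)
    (hPo : ∀ m l, m ≠ l → jacobiFunctional hα hβ (P m * P l) = 0)
    (hh : ∀ m, jacobiFunctional hα hβ (P m * P m) = h m)
    (g1 g2 : ℕ → ℝ)
    (hrec : ∀ m, X * P (m + 1) =
      P (m + 2) + Polynomial.C (g1 m) * P (m + 1) + Polynomial.C (g2 m) * P m)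
    {m : ℕ} {S : ℝ[X]} (hSm : S.Monic) (hSd : S.natDegree = m + 1)
    (hSo : ∀ l < m + 1, sobolevIP α β c dd lam (X ^ l) S = 0) :
    rhoPoly c dd * S =
      (rhoPoly c dd - ∑ j : Fin N, ∑ k ∈ Finset.range (dd j + 1),
        Polynomial.C ((Nat.factorial k : ℝ) * lam j k * (iterDeriv k S).eval (c j) / h m) *
          (taylorPoly k (c j) (P m) * rhoJK c dd j k)) * P (m + 1) +
      (∑ j : Fin N, ∑ k ∈ Finset.range (dd j + 1),
        Polynomial.C ((Nat.factorial k : ℝ) * lam j k * (iterDeriv k S).eval (c j) / h m) *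
          (taylorPoly k (c j) (P (m + 1)) * rhoJK c dd j k)) * P m := by
  have hg : ∀ m, h (m + 1) = g2 m * h m := fun m =>
    norm_sq_eq_mul_of_recurrence hPm hPd hPo hh (hrec m)
  have hdeg : (S - P (m + 1)).degree < ((m + 1 : ℕ) : WithBot ℕ) := by
    have hSdeg : S.degree = ((m + 1 : ℕ) : WithBot ℕ) := by
      rw [degree_eq_natDegree hSm.ne_zero, hSd]
    rw [← hSdeg]
    refine degree_sub_lt_left ?_ hSm.ne_zero (hSm.leadingCoeff.trans (hPm _).leadingCoeff.symm)
    rw [hSdeg, degree_eq_natDegree (hPm _).ne_zero, hPd]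
  have hcoef : ∀ i ∈ Finset.range (m + 1), jacobiFunctional hα hβ (P i * (S - P (m + 1))) =
      -∑ j : Fin N, ∑ k ∈ Finset.range (dd j + 1),
        lam j k * (iterDeriv k (P i)).eval (c j) * (iterDeriv k S).eval (c j) := by
    intro i hi
    have hi' := Finset.mem_range.1 hi
    rw [mul_sub, map_sub, hPo _ _ hi'.ne, sub_zero]
    have := sobolevIP_eq_zero_of_degree_lt c dd lam hα hβ hSo (q := P i) (by
      rw [degree_eq_natDegree (hPm _).ne_zero, hPd]
      exact_mod_cast hi')
    rw [sobolevIP] at this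
    simp only [jacobiFunctional, LinearMap.coe_mk, AddHom.coe_mk, eval_mul]
    linarith
  have hS := eq_sum_orthogonal hPm hPd hPo hh h0 (m + 1) _ hdeg
  have hS' : S - P (m + 1) = -∑ j : Fin N, ∑ k ∈ Finset.range (dd j + 1),
      Polynomial.C (lam j k * (iterDeriv k S).eval (c j)) *
        ∑ i ∈ Finset.range (m + 1),
          Polynomial.C ((iterDeriv k (P i)).eval (c j) / h i) * P i := by
    rw [hS, Finset.sum_congr rfl fun i hi => by rw [hcoef i hi]]
    simp only [Finset.mul_sum, neg_div, neg_smul, Finset.sum_neg_distrib, Finset.sum_div,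
      Finset.sum_smul]
    rw [Finset.sum_comm]
    congr 1
    refine Finset.sum_congr rfl fun j _ => ?_
    rw [Finset.sum_comm]
    refine Finset.sum_congr rfl fun k _ => Finset.sum_congr rfl fun i _ => ?_
    rw [smul_eq_C_mul, ← mul_assoc, ← Polynomial.C_mul]
    congr 2
    ring
  have hterm : rhoPoly c dd * (S - P (m + 1)) = -∑ j : Fin N, ∑ k ∈ Finset.range (dd j + 1),
      (Polynomial.C ((Nat.factorial k : ℝ) * lam j k * (iterDeriv k S).eval (c j) / h m) *
          (taylorPoly k (c j) (P m) * rhoJK c dd j k) * P (m + 1) -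
        Polynomial.C ((Nat.factorial k : ℝ) * lam j k * (iterDeriv k S).eval (c j) / h m) *
          (taylorPoly k (c j) (P (m + 1)) * rhoJK c dd j k) * P m) := by
    rw [hS', mul_neg, Finset.mul_sum]
    congr 1
    refine Finset.sum_congr rfl fun j _ => ?_
    rw [Finset.mul_sum]
    refine Finset.sum_congr rfl fun k hk => ?_
    have hcd := christoffel_darboux_taylor hPm hPd h0 g1 g2 hrec hg (c j) k m
    have hC : Polynomial.C ((Nat.factorial k : ℝ) * lam j k * (iterDeriv k S).eval (c j) / h m) =
        Polynomial.C (lam j k * (iterDeriv k S).eval (c j)) *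
          Polynomial.C (Nat.factorial k / h m) := by
      rw [← Polynomial.C_mul]
      congr 1
      ring
    rw [← pow_mul_rhoJK c dd (Nat.lt_succ_iff.1 (Finset.mem_range.1 hk)), hC]
    linear_combination (Polynomial.C (lam j k * (iterDeriv k S).eval (c j)) * rhoJK c dd j k) * hcd
  simp only [Finset.sum_sub_distrib, ← Finset.sum_mul] at hterm
  linear_combination hterm

theorem stmt10 (α β : ℝ) (hα : -1 < α) (hβ : -1 < β)
    (N : ℕ) (hN : 1 ≤ N)
    (c : Fin N → ℝ) (hc : Function.Injective c) (hcout : ∀ j, c j ∉ Set.Ioo (-1 : ℝ) 1)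
    (dd : Fin N → ℕ) (hdd : Monotone dd)
    (lam : Fin N → ℕ → ℝ) (hlam : ∀ j k, 0 ≤ lam j k) (hlamd : ∀ j, 0 < lam j (dd j))
    (d : ℕ) (hd : d = ∑ j, (dd j + 1))
    (P : ℕ → Polynomial ℝ) (hPm : ∀ m, (P m).Monic) (hPd : ∀ m, (P m).natDegree = m)
    (hPo : ∀ m l, m ≠ l → ∫ x, (P m).eval x * (P l).eval x ∂(jacobiMeasure α β) = 0)
    (h : ℕ → ℝ) (hh : ∀ m, h m = ∫ x, ((P m).eval x) ^ 2 ∂(jacobiMeasure α β))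
    (S : ℕ → Polynomial ℝ) (hSm : ∀ m, (S m).Monic) (hSd : ∀ m, (S m).natDegree = m)
    (hSo : ∀ m l, l < m → sobolevIP α β c dd lam (X ^ l) (S m) = 0)
    (A2 B2 : ℕ → Polynomial ℝ)
    (hA2 : ∀ m, 1 ≤ m → A2 m = rhoPoly c dd -
      ∑ j : Fin N, ∑ k ∈ Finset.range (dd j + 1),
        Polynomial.C ((Nat.factorial k : ℝ) * lam j k * (iterDeriv k (S m)).eval (c j) / h (m - 1)) *
          (taylorPoly k (c j) (P (m - 1)) * rhoJK c dd j k))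
    (hB2 : ∀ m, 1 ≤ m → B2 m =
      ∑ j : Fin N, ∑ k ∈ Finset.range (dd j + 1),
        Polynomial.C ((Nat.factorial k : ℝ) * lam j k * (iterDeriv k (S m)).eval (c j) / h (m - 1)) *
          (taylorPoly k (c j) (P m) * rhoJK c dd j k))
    (hrec : ∀ m, 1 ≤ m → X * P m =
      P (m + 1) + Polynomial.C (gamma1 α β m) * P m + Polynomial.C (gamma2 α β m) * P (m - 1))
    (C2 D2 : ℕ → Polynomial ℝ)
    (hC2 : ∀ m, 2 ≤ m → C2 m = Polynomial.C (-(1 / gamma2 α β (m - 1))) * B2 (m - 1))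
    (hD2 : ∀ m, 2 ≤ m → D2 m = A2 (m - 1) +
      Polynomial.C (1 / gamma2 α β (m - 1)) * B2 (m - 1) * (X - Polynomial.C (gamma1 α β (m - 1))))
    (n : ℕ) (hn : 2 ≤ n) :
    rhoPoly c dd * S (n - 1) = C2 n * P n + D2 n * P (n - 1) ∧
      (C2 n).natDegree ≤ d - 1 ∧ (D2 n).natDegree ≤ d := by
  obtain ⟨m, rfl⟩ : ∃ m, n = m + 2 := ⟨n - 2, by omega⟩
  have hpos : ∀ m, h m ≠ 0 := fun m => by
    rw [hh]
    exact (integral_sq_jacobiMeasure_pos hα hβ (hPm m).ne_zero).ne'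
  have hPo' : ∀ m l, m ≠ l → jacobiFunctional hα hβ (P m * P l) = 0 := fun m l hml => by
    simpa [jacobiFunctional] using hPo m l hml
  have hh' : ∀ m, jacobiFunctional hα hβ (P m * P m) = h m := fun m => by
    simp [jacobiFunctional, hh, sq]
  have hrec' : ∀ m, X * P (m + 1) = P (m + 2) + Polynomial.C (gamma1 α β (m + 1)) * P (m + 1) +
      Polynomial.C (gamma2 α β (m + 1)) * P m := fun m => hrec (m + 1) (by omega)
  have hγ : gamma2 α β (m + 1) ≠ 0 := fun h0 => hpos (m + 1) <| by
    rw [norm_sq_eq_mul_of_recurrence hPm hPd hPo' hh' (hrec' m), h0, zero_mul]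
  have key := rhoPoly_mul_eq hα hβ c dd lam hPm hPd hpos hPo' hh' (fun m => gamma1 α β (m + 1))
    (fun m => gamma2 α β (m + 1)) hrec' (hSm (m + 1)) (hSd (m + 1)) (hSo (m + 1))
  have hA := hA2 (m + 1) (by omega)
  have hB := hB2 (m + 1) (by omega)
  have hC := hC2 (m + 2) hn
  have hD := hD2 (m + 2) hn
  simp only [show m + 2 - 1 = m + 1 from rfl, Nat.add_sub_cancel] at hA hB hC hD ⊢
  rw [← hA, ← hB] at key
  have hd1 : 1 ≤ d := by
    rw [hd]
    exact (Nat.succ_le_succ (Nat.zero_le _)).trans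
      (Finset.single_le_sum (fun j _ => Nat.zero_le (dd j + 1)) (Finset.mem_univ (⟨0, hN⟩ : Fin N)))
  have hBdeg : (B2 (m + 1)).natDegree ≤ d - 1 := by
    rw [hB, hd]
    exact natDegree_sum_taylorPoly_mul_rhoJK_le c dd _ _
  have hAdeg : (A2 (m + 1)).natDegree ≤ d := by
    rw [hA]
    refine (natDegree_sub_le _ _).trans (max_le ?_ ?_)
    · rw [natDegree_rhoPoly, hd]
    · refine (natDegree_sum_taylorPoly_mul_rhoJK_le c dd _ _).trans ?_
      omega
  refine ⟨?_, ?_, ?_⟩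
  · have hinv : Polynomial.C (1 / gamma2 α β (m + 1)) * Polynomial.C (gamma2 α β (m + 1)) = 1 := by
      rw [← Polynomial.C_mul, one_div_mul_cancel hγ, Polynomial.C_1]
    rw [key, hC, hD, Polynomial.C_neg]
    linear_combination (-Polynomial.C (1 / gamma2 α β (m + 1)) * B2 (m + 1)) * hrec' m -
      B2 (m + 1) * P m * hinv
  · rw [hC]
    exact (natDegree_C_mul_le _ _).trans hBdeg
  · rw [hD]
    refine (natDegree_add_le _ _).trans (max_le hAdeg ?_)
    refine natDegree_mul_le.trans ?_
    have := natDegree_C_mul_le (1 / gamma2 α β (m + 1)) (B2 (m + 1))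
    rw [natDegree_X_sub_C]
    omega
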